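/- arXiv:1303.2572 — 8 statements merged into one kernel-verified Lean document; each statement's English description precedes it below -/
import Mathlib

section
/- Let L be a first-order language having only relation symbols and let X be an L-structure. Then the poset ⟨P(X),⊆⟩ is either atomless or atomic. -/
open FirstOrder

/-- For a relational language, every subset of an `L`-structure carries the induced structure. -/
instance setStructure (L : FirstOrder.Language) [L.IsRelational] {M : Type*} [L.Structure M]
    (s : Set M) : L.Structure s where
  funMap f _ := isEmptyElim f
  RelMap r x := Language.Structure.RelMap r (fun i => (x i : M))

/-- `Copies L M` is the family of domains of substructures of `M` isomorphic to `M`. -/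
def Copies (L : FirstOrder.Language) [L.IsRelational] (M : Type*) [L.Structure M] :
    Set (Set M) :=
  {A : Set M | Nonempty (L.Equiv A M)}

/-- Two elements of a family `S` of sets (a poset under `⊆`) are compatible iff they have a
common lower bound in `S`. -/
def Compat {M : Type*} (S : Set (Set M)) (p q : Set M) : Prop :=
  ∃ r ∈ S, r ⊆ p ∧ r ⊆ q

/-- `p` is an atom of the poset `⟨S,⊆⟩` iff any two elements of `S` below `p` are compatible. -/
def IsForcingAtom {M : Type*} (S : Set (Set M)) (p : Set M) : Prop :=
  ∀ q ∈ S, q ⊆ p → ∀ r ∈ S, r ⊆ p → Compat S q r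

/-- The poset `⟨S,⊆⟩` is atomless iff it has no atoms. -/
def Atomless {M : Type*} (S : Set (Set M)) : Prop :=
  ∀ p ∈ S, ¬ IsForcingAtom S p

/-- The poset `⟨S,⊆⟩` is atomic iff below every element there is an atom. -/
def Atomic {M : Type*} (S : Set (Set M)) : Prop :=
  ∀ p ∈ S, ∃ q ∈ S, q ⊆ p ∧ IsForcingAtom S q

/-- An embedding restricts to an isomorphism from any set onto its image. -/
theorem nonempty_equiv_image {L : FirstOrder.Language} [L.IsRelational] {M : Type*}
    [L.Structure M] (g : L.Embedding M M) (B : Set M) : Nonempty (L.Equiv B (g '' B)) :=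
  ⟨{ Equiv.Set.image g B g.injective with
      map_fun' := fun f => isEmptyElim f
      map_rel' := fun r x => g.map_rel r fun i => (x i : M) }⟩

/-- Images under an embedding of `M` preserve and reflect being a copy of `M`. -/
theorem image_mem_copies_iff {L : FirstOrder.Language} [L.IsRelational] {M : Type*}
    [L.Structure M] (g : L.Embedding M M) {B : Set M} :
    g '' B ∈ Copies L M ↔ B ∈ Copies L M := by
  obtain ⟨e⟩ := nonempty_equiv_image g B
  exact ⟨fun ⟨f⟩ => ⟨f.comp e⟩, fun ⟨f⟩ => ⟨f.comp e.symm⟩⟩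

/-- Every copy of `M` is the range of an embedding of `M` into itself. -/
theorem exists_embedding_range_eq {L : FirstOrder.Language} [L.IsRelational] {M : Type*}
    [L.Structure M] {A : Set M} (hA : A ∈ Copies L M) :
    ∃ g : L.Embedding M M, Set.range g = A := by
  obtain ⟨e⟩ := hA
  let i : L.Embedding A M :=
    { toFun := Subtype.val
      inj' := Subtype.val_injective
      map_fun' := fun f => isEmptyElim f
      map_rel' := fun _ _ => Iff.rfl }
  refine ⟨i.comp e.symm.toEmbedding, ?_⟩
  ext x
  constructor
  · rintro ⟨y, rfl⟩
    exact (e.symm y).2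
  · intro hx
    exact ⟨e ⟨x, hx⟩, congrArg Subtype.val (e.symm_apply_apply ⟨x, hx⟩)⟩

/-- If some copy of `M` is an atom then any two copies of `M` are compatible. -/
theorem compat_of_isForcingAtom {L : FirstOrder.Language} [L.IsRelational] {M : Type*}
    [L.Structure M] {A : Set M} (hA : A ∈ Copies L M) (hatom : IsForcingAtom (Copies L M) A)
    {q r : Set M} (hq : q ∈ Copies L M) (hr : r ∈ Copies L M) : Compat (Copies L M) q r := by
  obtain ⟨g, rfl⟩ := exists_embedding_range_eq hA
  obtain ⟨s, hs, hsq, hsr⟩ := hatom (g '' q) ((image_mem_copies_iff g).2 hq)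
    (Set.image_subset_range g q) (g '' r) ((image_mem_copies_iff g).2 hr)
    (Set.image_subset_range g r)
  obtain ⟨t, rfl⟩ := Set.subset_range_iff_exists_image_eq.1
    (hsq.trans (Set.image_subset_range g q))
  exact ⟨t, (image_mem_copies_iff g).1 hs, (Set.image_subset_image_iff g.injective).1 hsq,
    (Set.image_subset_image_iff g.injective).1 hsr⟩

/-- The poset `⟨P(X),⊆⟩` is either atomless or atomic. -/
theorem copies_atomless_or_atomic (L : FirstOrder.Language) [L.IsRelational]
    (M : Type*) [L.Structure M] :
    Atomless (Copies L M) ∨ Atomic (Copies L M) := by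
  by_cases h : Atomless (Copies L M)
  · exact Or.inl h
  · simp only [Atomless, not_forall, not_not] at h
    obtain ⟨A, hA, hatom⟩ := h
    exact Or.inr fun p hp => ⟨p, hp, subset_rfl, fun _ hq _ _ hr _ =>
      compat_of_isForcingAtom hA hatom hq hr⟩
end

section
/- Let L be a first-order language having only relation symbols and let X be an L-structure. Then the poset ⟨P(X),⊆⟩ is atomless if and only if it contains two incompatible elements, i.e. there exist A,B ∈ P(X) such that no C ∈ P(X) satisfies C ⊆ A ∩ B. -/
open FirstOrder

/-- The copies of `M` inside `M` are exactly the ranges of self-embeddings of `M`. -/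
theorem mem_copies_iff (L : FirstOrder.Language) [L.IsRelational]
    {M : Type*} [L.Structure M] {A : Set M} :
    A ∈ Copies L M ↔ ∃ f : L.Embedding M M, Set.range f = A := by
  constructor
  · rintro ⟨e⟩
    refine ⟨⟨⟨fun x => (e.symm x : M), fun x y h => e.symm.injective (Subtype.ext h)⟩,
      fun f => isEmptyElim f, fun r x => e.symm.map_rel r x⟩, ?_⟩
    ext a
    constructor
    · rintro ⟨x, rfl⟩
      exact (e.symm x).2
    · intro ha
      exact ⟨e ⟨a, ha⟩, congrArg Subtype.val (e.symm_apply_apply ⟨a, ha⟩)⟩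
  · rintro ⟨f, rfl⟩
    let e : L.Equiv M (Set.range f) :=
      ⟨Equiv.ofInjective f f.injective, fun g => isEmptyElim g, fun r x => f.map_rel r x⟩
    exact ⟨e.symm⟩

/-- A self-embedding whose range lies in that of `f` factors through `f`. -/
theorem exists_embedding_comp_eq (L : FirstOrder.Language) [L.IsRelational]
    {M : Type*} [L.Structure M] (f h : L.Embedding M M) (hr : Set.range h ⊆ Set.range f) :
    ∃ k : L.Embedding M M, ∀ x, f (k x) = h x := by
  choose k hk using fun x => hr ⟨x, rfl⟩
  refine ⟨⟨⟨k, fun x y hxy => h.injective ?_⟩, fun g => isEmptyElim g, fun r x => ?_⟩, hk⟩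
  · rw [← hk x, ← hk y, hxy]
  · have hcomp : f ∘ (k ∘ x) = h ∘ x := funext fun i => hk (x i)
    exact (f.map_rel r (k ∘ x)).symm.trans (hcomp ▸ h.map_rel r x)

/-- The poset `⟨P(X),⊆⟩` is atomless iff it contains two incompatible elements, i.e. there are
`A, B ∈ P(X)` such that no `C ∈ P(X)` satisfies `C ⊆ A ∩ B`. -/
theorem copies_atomless_iff_incompatible (L : FirstOrder.Language) [L.IsRelational]
    (M : Type*) [L.Structure M] :
    Atomless (Copies L M) ↔
      ∃ A ∈ Copies L M, ∃ B ∈ Copies L M, ¬ ∃ C ∈ Copies L M, C ⊆ A ∩ B := by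
  constructor
  · intro h
    by_contra! hc
    refine h Set.univ ((mem_copies_iff L).2
      ⟨FirstOrder.Language.Embedding.refl L M, Set.range_id⟩) fun q hq _ r hr _ => ?_
    obtain ⟨C, hC, hCqr⟩ := hc q hq r hr
    exact ⟨C, hC, Set.subset_inter_iff.1 hCqr⟩
  · rintro ⟨A, hA, B, hB, hAB⟩ p hp hatom
    obtain ⟨f, rfl⟩ := (mem_copies_iff L).1 hp
    have himage : ∀ D ∈ Copies L M, f '' D ∈ Copies L M := fun D hD => by
      obtain ⟨g, rfl⟩ := (mem_copies_iff L).1 hD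
      exact (mem_copies_iff L).2 ⟨f.comp g, Set.range_comp f g⟩
    obtain ⟨C, hC, hCA, hCB⟩ := hatom _ (himage A hA) (Set.image_subset_range f A)
      _ (himage B hB) (Set.image_subset_range f B)
    obtain ⟨h, rfl⟩ := (mem_copies_iff L).1 hC
    obtain ⟨k, hk⟩ := exists_embedding_comp_eq L f h (hCA.trans (Set.image_subset_range f A))
    refine hAB ⟨Set.range k, (mem_copies_iff L).2 ⟨k, rfl⟩, ?_⟩
    rintro _ ⟨x, rfl⟩
    have hmem : ∀ D : Set M, Set.range h ⊆ f '' D → k x ∈ D := fun D hD =>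
      f.injective.mem_set_image.1 (hk x ▸ hD ⟨x, rfl⟩)
    exact ⟨hmem A hCA, hmem B hCB⟩
end

section
/- Let G = ⟨2^{<ω}, ρ⟩ be the digraph on the set 2^{<ω} of finite binary sequences with ρ = {⟨φ, φ⌢i⟩ : φ ∈ 2^{<ω}, i ∈ {0,1}}, and for φ ∈ 2^{<ω} let A_φ = {ψ ∈ 2^{<ω} : φ is an initial segment of ψ}. Then P(G) = {A_φ : φ ∈ 2^{<ω}}, and the map φ ↦ A_φ is an order isomorphism from ⟨2^{<ω}, ⊇⟩ onto ⟨P(G), ⊆⟩. -/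
/-- `f` is an embedding of the binary structure `⟨X,ρ⟩` into `⟨Y,σ⟩`: an injection preserving
the relation in both directions. -/
def BinEmb {X Y : Type*} (ρ : X → X → Prop) (σ : Y → Y → Prop) (f : X → Y) : Prop :=
  Function.Injective f ∧ ∀ x₁ x₂, ρ x₁ x₂ ↔ σ (f x₁) (f x₂)

/-- The binary structures `⟨X,ρ⟩` and `⟨Y,σ⟩` are isomorphic: there is a bijection preserving
the relation in both directions. -/
def BinIso {X Y : Type*} (ρ : X → X → Prop) (σ : Y → Y → Prop) : Prop :=
  ∃ e : X ≃ Y, ∀ x₁ x₂, ρ x₁ x₂ ↔ σ (e x₁) (e x₂)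

/-- `P(X)` for a binary structure `⟨X,ρ⟩`: the family of sets `A ⊆ X` whose induced
substructure is isomorphic to `⟨X,ρ⟩`. -/
def BinCopies {X : Type*} (ρ : X → X → Prop) : Set (Set X) :=
  {A : Set X | BinIso ρ (fun a b : A => ρ a b)}

/-- The successor digraph on the complete binary tree `2^{<ω}`. -/
def treeRel (φ ψ : List Bool) : Prop := ∃ i : Bool, ψ = φ ++ [i]

/-- `A_φ`: the set of binary sequences extending `φ`. -/
def coneSet (φ : List Bool) : Set (List Bool) := {ψ : List Bool | φ <+: ψ}

theorem prefix_apply_of_treeRel {f : List Bool → List Bool}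
    (hf : ∀ s i, treeRel (f s) (f (s ++ [i]))) (s : List Bool) : f [] <+: f s := by
  induction s using List.reverseRecOn with
  | nil => exact List.prefix_rfl
  | append_singleton s i ih =>
    obtain ⟨j, hj⟩ := hf s i
    exact hj ▸ ih.trans (List.prefix_append _ _)

theorem exists_apply_eq_append_of_treeRel {f : List Bool → List Bool}
    (hinj : Function.Injective f) (hf : ∀ s i, treeRel (f s) (f (s ++ [i]))) (t : List Bool) :
    ∃ s, f s = f [] ++ t := by
  induction t using List.reverseRecOn with
  | nil => exact ⟨[], by simp⟩
  | append_singleton t i ih =>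
    obtain ⟨s, hs⟩ := ih
    choose c hc using hf s
    have hcinj : Function.Injective c := fun a b hab => by
      have h : f (s ++ [a]) = f (s ++ [b]) := by rw [hc, hc, hab]
      simpa using hinj h
    obtain ⟨j, rfl⟩ := Finite.surjective_of_injective hcinj i
    exact ⟨s ++ [j], by rw [hc, hs, List.append_assoc]⟩

theorem range_eq_coneSet_of_treeRel {f : List Bool → List Bool}
    (hinj : Function.Injective f) (hf : ∀ s i, treeRel (f s) (f (s ++ [i]))) :
    Set.range f = coneSet (f []) := by
  ext ψ
  constructor
  · rintro ⟨s, rfl⟩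
    exact prefix_apply_of_treeRel hf s
  · rintro ⟨t, rfl⟩
    exact exists_apply_eq_append_of_treeRel hinj hf t

theorem treeRel_append_left (φ s t : List Bool) :
    treeRel (φ ++ s) (φ ++ t) ↔ treeRel s t := by
  simp [treeRel, List.append_assoc]

theorem coneSet_mem_binCopies (φ : List Bool) : coneSet φ ∈ BinCopies treeRel := by
  refine ⟨Equiv.ofBijective (fun s => ⟨φ ++ s, List.prefix_append φ s⟩) ⟨?_, ?_⟩, ?_⟩
  · exact fun s t h => List.append_cancel_left (congrArg Subtype.val h)
  · rintro ⟨_, s, rfl⟩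
    exact ⟨s, rfl⟩
  · exact fun s t => (treeRel_append_left φ s t).symm

theorem coneSet_subset_coneSet (φ ψ : List Bool) : coneSet φ ⊆ coneSet ψ ↔ ψ <+: φ :=
  ⟨fun h => h (List.prefix_rfl : φ <+: φ), fun h _ hχ => h.trans hχ⟩

theorem coneSet_injective : Function.Injective coneSet := fun φ ψ h =>
  ((coneSet_subset_coneSet ψ φ).1 h.ge).eq_of_length_le
    ((coneSet_subset_coneSet φ ψ).1 h.le).length_le

/-- For the digraph `G = ⟨2^{<ω}, ρ⟩` with `ρ = {⟨φ, φ⌢i⟩}`, the copies of `G` are exactly the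
sets `A_φ = {ψ : φ ⊆ ψ}`, and `φ ↦ A_φ` is an order isomorphism from `⟨2^{<ω},⊇⟩` onto
`⟨P(G),⊆⟩`. -/
theorem copies_of_binary_tree :
    BinCopies treeRel = {B : Set (List Bool) | ∃ φ : List Bool, B = coneSet φ} ∧
    Function.Injective coneSet ∧
    (∀ φ ψ : List Bool, coneSet φ ⊆ coneSet ψ ↔ ψ <+: φ) := by
  refine ⟨?_, coneSet_injective, coneSet_subset_coneSet⟩
  ext B
  constructor
  · rintro ⟨e, he⟩
    have h := range_eq_coneSet_of_treeRel (f := fun s => (e s : List Bool))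
      (Subtype.val_injective.comp e.injective) fun s i => (he _ _).1 ⟨i, rfl⟩
    exact ⟨e [], Subtype.range_val.symm.trans
      ((e.surjective.range_comp Subtype.val).symm.trans h)⟩
  · rintro ⟨φ, rfl⟩
    exact coneSet_mem_binCopies φ
end

section
/- Let L be a first-order language having only relation symbols and let X be an indivisible L-structure with domain ℕ. Then |P(X)| = 2^{ℵ₀}. -/
open FirstOrder

/-- `I_X`: the family of subsets of the domain containing no copy of the structure. -/
def CopiesIdeal (L : FirstOrder.Language) [L.IsRelational] (M : Type*) [L.Structure M] :
    Set (Set M) :=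
  {S : Set M | ¬ ∃ A ∈ Copies L M, A ⊆ S}

/-- A structure is indivisible iff for every subset `S` of its domain it embeds into the induced
substructure on `S` or into the induced substructure on the complement of `S`. -/
def Indivisible (L : FirstOrder.Language) [L.IsRelational] (M : Type*) [L.Structure M] : Prop :=
  ∀ S : Set M, Nonempty (L.Embedding M S) ∨ Nonempty (L.Embedding M ↥(Sᶜ))

section PerfectImage

open Set Filter Topology CantorScheme
open scoped ENNReal

/-- A closed set with uncountable image under a continuous map contains two closed subsets of small
diameter whose images are uncountable and disjoint. -/
theorem IsClosed.small_diam_splitting_image {α β : Type*} [MetricSpace α]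
    [SecondCountableTopology α] [TopologicalSpace β] [T2Space β] {f : α → β} (hf : Continuous f)
    {C : Set α} (hC : IsClosed C) (hunc : ¬(f '' C).Countable) {ε : ℝ≥0∞} (hε : 0 < ε) :
    ∃ C₀ C₁ : Set α,
      (IsClosed C₀ ∧ ¬(f '' C₀).Countable ∧ C₀ ⊆ C ∧ Metric.ediam C₀ ≤ ε) ∧
      (IsClosed C₁ ∧ ¬(f '' C₁).Countable ∧ C₁ ⊆ C ∧ Metric.ediam C₁ ≤ ε) ∧
      Disjoint (f '' C₀) (f '' C₁) := by
  let B : Set α := {x | x ∈ C ∧ ∃ W ∈ 𝓝 x, (f '' (C ∩ W)).Countable}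
  have hB : (f '' B).Countable := by
    choose! W hW hWc using fun x (hx : x ∈ B) => hx.2
    obtain ⟨t, htB, htc, ht⟩ := TopologicalSpace.countable_cover_nhdsWithin
      fun x hx => mem_nhdsWithin_of_mem_nhds (s := W x) (t := B) (hW x hx)
    refine (htc.biUnion fun x hx => hWc x (htB hx)).mono ?_
    rintro _ ⟨x, hx, rfl⟩
    obtain ⟨y, hy, hxy⟩ := mem_iUnion₂.1 (ht hx)
    exact mem_iUnion₂.2 ⟨y, hy, x, ⟨hx.1, hxy⟩, rfl⟩
  have hns : ¬(f '' (C \ B)).Subsingleton := fun hs => hunc <|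
    (hB.union hs.countable).mono <| by
      rw [← image_union]
      exact image_mono fun x hx => by
        by_cases hxB : x ∈ B
        · exact Or.inl hxB
        · exact Or.inr ⟨hx, hxB⟩
  obtain ⟨_, ⟨x₀, hx₀, rfl⟩, _, ⟨x₁, hx₁, rfl⟩, hne⟩ := not_subsingleton_iff.1 hns
  obtain ⟨O₀, O₁, hO₀, hO₁, hxO₀, hxO₁, hO⟩ := t2_separation hne
  have shrink : ∀ x ∈ C \ B, ∀ O : Set β, IsOpen O → f x ∈ O → ∃ D : Set α,
      (IsClosed D ∧ ¬(f '' D).Countable ∧ D ⊆ C ∧ Metric.ediam D ≤ ε) ∧ f '' D ⊆ O := by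
    intro x hx O hO hxO
    obtain ⟨K, hK, hKc, hKs⟩ := exists_mem_nhds_isClosed_subset
      (inter_mem (hf.continuousAt.preimage_mem_nhds (hO.mem_nhds hxO))
        (Metric.eball_mem_nhds x (ENNReal.half_pos hε.ne')))
    refine ⟨C ∩ K, ⟨hC.inter hKc, fun h => hx.2 ⟨hx.1, K, hK, h⟩, inter_subset_left, ?_⟩, ?_⟩
    · calc Metric.ediam (C ∩ K) ≤ Metric.ediam (Metric.eball x (ε / 2)) :=
            Metric.ediam_mono fun y hy => (hKs hy.2).2
        _ ≤ 2 * (ε / 2) := Metric.ediam_eball_le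
        _ = ε := ENNReal.mul_div_cancel (by simp) (by simp)
    · rintro _ ⟨y, hy, rfl⟩
      exact (hKs hy.2).1
  obtain ⟨D₀, hD₀, hDO₀⟩ := shrink x₀ hx₀ O₀ hO₀ hxO₀
  obtain ⟨D₁, hD₁, hDO₁⟩ := shrink x₁ hx₁ O₁ hO₁ hxO₁
  exact ⟨D₀, D₁, hD₀, hD₁, hO.mono hDO₀ hDO₁⟩

/-- If a continuous map has uncountable image on a closed subset of a Polish space, then that set
contains a continuous copy of the Cantor space on which the map is injective. -/
theorem IsClosed.exists_nat_bool_injective_comp_of_image_not_countable {α β : Type*}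
    [TopologicalSpace α] [PolishSpace α] [TopologicalSpace β] [T2Space β] {f : α → β}
    (hf : Continuous f) {C : Set α} (hC : IsClosed C) (hunc : ¬(f '' C).Countable) :
    ∃ g : (ℕ → Bool) → α, range g ⊆ C ∧ Continuous g ∧ Function.Injective (f ∘ g) := by
  let := TopologicalSpace.upgradeIsCompletelyMetrizable α
  obtain ⟨u, -, upos', hu⟩ := exists_seq_strictAnti_tendsto' (zero_lt_one' ℝ≥0∞)
  have upos := fun n => (upos' n).1
  let P := Subtype fun E : Set α => IsClosed E ∧ ¬(f '' E).Countable
  choose C0 C1 h0 h1 hdisj using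
    fun {C : Set α} (hC : IsClosed C) (hunc : ¬(f '' C).Countable) {ε : ℝ≥0∞} (hε : 0 < ε) =>
    hC.small_diam_splitting_image hf hunc hε
  let DP : List Bool → P := fun l => by
    induction l with
    | nil => exact ⟨C, ⟨hC, hunc⟩⟩
    | cons a l ih =>
      cases a
      · use C0 ih.property.1 ih.property.2 (upos (l.length + 1))
        exact ⟨(h0 _ _ _).1, (h0 _ _ _).2.1⟩
      use C1 ih.property.1 ih.property.2 (upos (l.length + 1))
      exact ⟨(h1 _ _ _).1, (h1 _ _ _).2.1⟩
  let D : List Bool → Set α := fun l => (DP l).val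
  have hanti : ClosureAntitone D := by
    refine Antitone.closureAntitone ?_ fun l => (DP l).property.1
    intro l a
    cases a
    · exact (h0 _ _ _).2.2.1
    exact (h1 _ _ _).2.2.1
  have hdiam : VanishingDiam D := by
    intro x
    apply tendsto_of_tendsto_of_tendsto_of_le_of_le' tendsto_const_nhds hu
    · simp
    rw [eventually_atTop]
    refine ⟨1, fun m (hm : 1 ≤ m) => ?_⟩
    obtain ⟨n, rfl⟩ := Nat.exists_eq_succ_of_ne_zero (Nat.one_le_iff_ne_zero.1 hm)
    dsimp
    cases x n
    · convert! (h0 _ _ _).2.2.2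
      rw [PiNat.res_length]
    convert! (h1 _ _ _).2.2.2
    rw [PiNat.res_length]
  have hdisj' : CantorScheme.Disjoint fun l => f '' D l := by
    rintro l (a | a) (b | b) hab <;> try contradiction
    · exact hdisj _ _ _
    exact (hdisj _ _ _).symm
  have hdom : ∀ {x : ℕ → Bool}, x ∈ (inducedMap D).1 := fun {x} => by
    rw [hanti.map_of_vanishingDiam hdiam fun l => ?_]
    · apply mem_univ
    · refine nonempty_iff_ne_empty.2 fun h => (DP l).property.2 ?_
      rw [show (DP l).val = ∅ from h, image_empty]
      exact countable_empty
  refine ⟨fun x => (inducedMap D).2 ⟨x, hdom⟩, ?_, ?_, ?_⟩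
  · rintro y ⟨x, rfl⟩
    exact map_mem ⟨_, hdom⟩ 0
  · apply hdiam.map_continuous.comp
    fun_prop
  · intro x y hxy
    have hmem (z : ℕ → Bool) (n : ℕ) :
        f ((inducedMap D).2 ⟨z, hdom⟩) ∈ f '' D (PiNat.res z n) :=
      mem_image_of_mem f (map_mem ⟨z, hdom⟩ n)
    apply PiNat.res_injective
    ext n : 1
    induction n with
    | zero => simp
    | succ n ih =>
      have hx := hmem x (n + 1)
      have hy := hmem y (n + 1)
      rw [show f ((inducedMap D).2 ⟨x, hdom⟩) = f ((inducedMap D).2 ⟨y, hdom⟩) from hxy] at hx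
      rw [PiNat.res_succ] at hx hy ⊢
      rw [PiNat.res_succ]
      rw [ih] at hx ⊢
      congr 1
      by_contra hne
      exact Set.disjoint_left.1 (hdisj' _ hne) hx hy

end PerfectImage

section Copies

open Set Filter FirstOrder.Language

/-- The range of a self-embedding of a relational structure is a copy of the structure. -/
theorem range_mem_copies {L : FirstOrder.Language} [L.IsRelational] {M : Type*} [L.Structure M]
    {e : M → M} (he : Function.Injective e)
    (hr : ∀ (n : ℕ) (r : L.Relations n) (x : Fin n → M),
      Structure.RelMap r (e ∘ x) ↔ Structure.RelMap r x) :
    range e ∈ Copies L M :=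
  ⟨FirstOrder.Language.Equiv.symm
    { toEquiv := Equiv.ofInjective e he
      map_fun' := fun f => isEmptyElim f
      map_rel' := fun r x => hr _ r x }⟩

/-- Every copy of a relational structure is the range of a self-embedding. -/
theorem exists_range_eq_of_mem_copies {L : FirstOrder.Language} [L.IsRelational] {M : Type*}
    [L.Structure M] {A : Set M} (hA : A ∈ Copies L M) :
    ∃ e : M → M, Function.Injective e ∧ (∀ (n : ℕ) (r : L.Relations n) (x : Fin n → M),
      Structure.RelMap r (e ∘ x) ↔ Structure.RelMap r x) ∧ range e = A := by
  obtain ⟨φ⟩ := hA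
  refine ⟨fun m => (φ.symm m : M), Subtype.val_injective.comp φ.symm.injective,
    fun n r x => φ.symm.map_rel r x, ?_⟩
  rw [show (fun m => (φ.symm m : M)) = Subtype.val ∘ φ.symm from rfl, range_comp,
    φ.symm.surjective.range_eq, image_univ, Subtype.range_val]

/-- If a relational structure embeds into a subset, then that subset contains a copy of it. -/
theorem exists_mem_copies_subset {L : FirstOrder.Language} [L.IsRelational] {M : Type*}
    [L.Structure M] {S : Set M} (φ : L.Embedding M S) : ∃ A ∈ Copies L M, A ⊆ S :=
  ⟨range fun m => (φ m : M),
    range_mem_copies (Subtype.val_injective.comp φ.injective) fun _ r x => φ.map_rel r x,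
    by rintro _ ⟨m, rfl⟩; exact (φ m).2⟩

/-- Countably many infinite sets of natural numbers are simultaneously split by a single set. -/
theorem exists_splitting_of_countable {F : Set (Set ℕ)} (hF : F.Countable)
    (hinf : ∀ A ∈ F, A.Infinite) : ∃ S : Set ℕ, ∀ A ∈ F, ¬A ⊆ S ∧ ¬A ⊆ Sᶜ := by
  rcases F.eq_empty_or_nonempty with rfl | hne
  · exact ⟨∅, by simp⟩
  obtain ⟨A, rfl⟩ := hF.exists_eq_range hne
  obtain ⟨a, ha, haA⟩ := extraction_forall_of_frequently
    (P := fun n k => k ∈ A (n / 2))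
    fun n => Nat.frequently_atTop_iff_infinite.2 (hinf _ ⟨n / 2, rfl⟩)
  refine ⟨range fun n => a (2 * n), ?_⟩
  rintro _ ⟨n, rfl⟩
  constructor
  · intro h
    obtain ⟨m, hm⟩ := h (show a (2 * n + 1) ∈ A n by
      have := haA (2 * n + 1); rwa [show (2 * n + 1) / 2 = n by omega] at this)
    have := ha.injective hm
    omega
  · intro h
    exact h (show a (2 * n) ∈ A n by
      have := haA (2 * n); rwa [show (2 * n) / 2 = n by omega] at this) ⟨n, rfl⟩

/-- An indivisible structure on `ℕ` has uncountably many copies. -/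
theorem Indivisible.not_countable_copies {L : FirstOrder.Language} [L.IsRelational]
    [L.Structure ℕ] (h : Indivisible L ℕ) : ¬(Copies L ℕ).Countable := by
  intro hc
  obtain ⟨S, hS⟩ := exists_splitting_of_countable hc fun A hA => by
    obtain ⟨e, he, -, rfl⟩ := exists_range_eq_of_mem_copies hA
    exact infinite_range_of_injective he
  rcases h S with ⟨⟨φ⟩⟩ | ⟨⟨φ⟩⟩
  · obtain ⟨A, hA, hAS⟩ := exists_mem_copies_subset φ
    exact (hS A hA).1 hAS
  · obtain ⟨A, hA, hAS⟩ := exists_mem_copies_subset φ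
    exact (hS A hA).2 hAS

/-- Self-embeddings `e` of a structure on `ℕ`, paired with a code `i` of the partial inverse of `e`:
`i n = k + 1` when `e k = n`, and `i n = 0` when `n` is not in the range of `e`. -/
def codedEmbeddings (L : FirstOrder.Language) [L.Structure ℕ] : Set ((ℕ → ℕ) × (ℕ → ℕ)) :=
  {p | (∀ (n : ℕ) (r : L.Relations n) (x : Fin n → ℕ),
    Structure.RelMap r (p.1 ∘ x) ↔ Structure.RelMap r x) ∧ ∀ k n, p.1 k = n ↔ p.2 n = k + 1}

theorem isClosed_codedEmbeddings (L : FirstOrder.Language) [L.Structure ℕ] :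
    IsClosed (codedEmbeddings L) := by
  have h₁ (n : ℕ) (r : L.Relations n) (x : Fin n → ℕ) : IsClosed {p : (ℕ → ℕ) × (ℕ → ℕ) |
      Structure.RelMap r (p.1 ∘ x) ↔ Structure.RelMap r x} :=
    (isClosed_discrete {y : Fin n → ℕ | Structure.RelMap r y ↔ Structure.RelMap r x}).preimage
      (f := fun p : (ℕ → ℕ) × (ℕ → ℕ) => p.1 ∘ x) (by fun_prop)
  have h₂ (k n : ℕ) : IsClosed {p : (ℕ → ℕ) × (ℕ → ℕ) | p.1 k = n ↔ p.2 n = k + 1} :=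
    (isClosed_discrete {q : ℕ × ℕ | q.1 = n ↔ q.2 = k + 1}).preimage
      (f := fun p : (ℕ → ℕ) × (ℕ → ℕ) => (p.1 k, p.2 n)) (by fun_prop)
  have : codedEmbeddings L =
      (⋂ (n : ℕ) (r : L.Relations n) (x : Fin n → ℕ), {p : (ℕ → ℕ) × (ℕ → ℕ) |
        Structure.RelMap r (p.1 ∘ x) ↔ Structure.RelMap r x}) ∩
      ⋂ (k : ℕ) (n : ℕ), {p : (ℕ → ℕ) × (ℕ → ℕ) | p.1 k = n ↔ p.2 n = k + 1} := by
    ext p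
    simp [codedEmbeddings]
  rw [this]
  exact (isClosed_iInter fun n => isClosed_iInter fun r => isClosed_iInter fun x =>
    h₁ n r x).inter (isClosed_iInter fun k => isClosed_iInter fun n => h₂ k n)

/-- The indicator function of the range of a coded embedding. -/
def codedRange (p : (ℕ → ℕ) × (ℕ → ℕ)) : ℕ → Bool := fun n => decide (p.2 n ≠ 0)

theorem continuous_codedRange : Continuous codedRange :=
  continuous_pi fun n => (continuous_of_discreteTopology
    (f := fun k : ℕ => decide (k ≠ 0))).comp
      (by fun_prop : Continuous fun p : (ℕ → ℕ) × (ℕ → ℕ) => p.2 n)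

theorem setOf_codedRange_eq_range (L : FirstOrder.Language) [L.Structure ℕ]
    {p : (ℕ → ℕ) × (ℕ → ℕ)}
    (hp : p ∈ codedEmbeddings L) : {n | codedRange p n = true} = range p.1 := by
  ext n
  simp only [codedRange, mem_ofPred_eq, decide_eq_true_eq, mem_range]
  constructor
  · intro h
    obtain ⟨k, hk⟩ := Nat.exists_eq_succ_of_ne_zero h
    exact ⟨k, (hp.2 k n).2 hk⟩
  · rintro ⟨k, hk⟩
    rw [(hp.2 k n).1 hk]
    exact k.succ_ne_zero

theorem setOf_codedRange_mem_copies (L : FirstOrder.Language) [L.IsRelational]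
    [L.Structure ℕ] {p : (ℕ → ℕ) × (ℕ → ℕ)}
    (hp : p ∈ codedEmbeddings L) : {n | codedRange p n = true} ∈ Copies L ℕ := by
  rw [setOf_codedRange_eq_range L hp]
  refine range_mem_copies (fun k l hkl => ?_) hp.1
  have hk := (hp.2 k _).1 rfl
  have hl := (hp.2 l _).1 hkl.symm
  omega

theorem exists_codedEmbeddings_of_mem_copies (L : FirstOrder.Language) [L.IsRelational]
    [L.Structure ℕ] {A : Set ℕ}
    (hA : A ∈ Copies L ℕ) :
    ∃ p ∈ codedEmbeddings L, {n | codedRange p n = true} = A := by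
  classical
  obtain ⟨e, he, hr, rfl⟩ := exists_range_eq_of_mem_copies hA
  have hp : (e, fun n => if h : ∃ k, e k = n then h.choose + 1 else 0) ∈ codedEmbeddings L := by
    refine ⟨hr, fun k n => ⟨?_, fun hk => ?_⟩⟩
    · rintro rfl
      have h : ∃ l, e l = e k := ⟨k, rfl⟩
      simp only [dif_pos h, he h.choose_spec]
    · dsimp only at hk ⊢
      split_ifs at hk with h
      rw [← Nat.succ_injective hk]
      exact h.choose_spec
  exact ⟨_, hp, setOf_codedRange_eq_range L hp⟩

end Copies

/-- A countable indivisible relational structure has continuum many copies. -/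
theorem indivisible_copies_continuum (L : FirstOrder.Language) [L.IsRelational]
    [L.Structure ℕ] (h : Indivisible L ℕ) :
    Cardinal.mk (Copies L ℕ) = Cardinal.continuum := by
  have hunc : ¬(codedRange '' codedEmbeddings L).Countable := fun hc =>
    h.not_countable_copies <| (hc.image fun b : ℕ → Bool => {n | b n = true}).mono fun A hA => by
      obtain ⟨p, hp, rfl⟩ := exists_codedEmbeddings_of_mem_copies L hA
      exact ⟨_, ⟨p, hp, rfl⟩, rfl⟩
  obtain ⟨g, hg, -, hinj⟩ :=
    (isClosed_codedEmbeddings L).exists_nat_bool_injective_comp_of_image_not_countable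
      continuous_codedRange hunc
  apply le_antisymm
  · calc Cardinal.mk (Copies L ℕ) ≤ Cardinal.mk (Set ℕ) := Cardinal.mk_set_le _
      _ = Cardinal.continuum := by simp
  · have hle := Cardinal.mk_le_of_injective
      (f := fun b : ℕ → Bool => (⟨{n | codedRange (g b) n = true},
        setOf_codedRange_mem_copies L (hg ⟨b, rfl⟩)⟩ : Copies L ℕ)) fun b c hbc => hinj <| by
          funext n
          exact Bool.eq_iff_iff.2 (Set.ext_iff.1 (Subtype.ext_iff.1 hbc) n)
    simpa using hle
end

section
/- Let X = ⟨ℕ,ρ⟩ be a binary structure. Then P(X) is the set of all infinite subsets of ℕ if and only if X is isomorphic to one of the following eight structures: the empty relation ⟨ℕ,∅⟩; the complete graph ⟨ℕ, {(m,n) : m ≠ n}⟩; the natural strict linear order ⟨ℕ,<⟩; its inverse ⟨ℕ,>⟩; the diagonal relation ⟨ℕ, {(n,n) : n ∈ ℕ}⟩; the full relation ⟨ℕ, ℕ×ℕ⟩; the natural linear order ⟨ℕ,≤⟩; and its inverse ⟨ℕ,≥⟩. -/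
theorem BinIso.symm {X Y : Type*} {ρ : X → X → Prop} {σ : Y → Y → Prop} (h : BinIso ρ σ) :
    BinIso σ ρ := by
  obtain ⟨e, he⟩ := h
  exact ⟨e.symm, fun x y => by simp [he]⟩

theorem BinIso.trans {X Y Z : Type*} {ρ : X → X → Prop} {σ : Y → Y → Prop} {τ : Z → Z → Prop}
    (h : BinIso ρ σ) (h' : BinIso σ τ) : BinIso ρ τ := by
  obtain ⟨e, he⟩ := h
  obtain ⟨e', he'⟩ := h'
  exact ⟨e.trans e', fun x y => by simp [he, he']⟩

/-- The infinite Ramsey theorem for pairs: every colouring of the pairs of natural numbers with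
finitely many colours is constant on the increasing pairs of some subsequence. -/
theorem exists_strictMono_forall_lt_eq {κ : Type*} [Finite κ] (c : ℕ → ℕ → κ) :
    ∃ (g : ℕ → ℕ) (d : κ), StrictMono g ∧ ∀ m n, m < n → c (g m) (g n) = d := by
  have limit_colour : ∀ f : ℕ → κ, ∃ d, ∀ᶠ n in (Filter.hyperfilter ℕ : Filter ℕ), f n = d := by
    intro f
    obtain ⟨d, hd⟩ := ((Filter.hyperfilter ℕ).map f).eq_pure_of_finite
    refine ⟨d, ?_⟩
    have : {d} ∈ (Filter.hyperfilter ℕ).map f := by simp [hd]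
    exact this
  choose L hL using fun m => limit_colour (c m)
  obtain ⟨d, hd⟩ := limit_colour L
  obtain ⟨g, -, hg⟩ := exists_seq_of_forall_finset_exists (fun m => L m = d)
    (fun m n => m < n ∧ c m n = d) (by
      intro s hs
      have hsd : ∀ᶠ n in (Filter.hyperfilter ℕ : Filter ℕ), ∀ m ∈ s, m < n ∧ c m n = d := by
        rw [Filter.eventually_all_finset]
        intro m hm
        have hgt : ∀ᶠ n in (Filter.hyperfilter ℕ : Filter ℕ), m < n :=
          Nat.hyperfilter_le_atTop (Filter.eventually_gt_atTop m)
        filter_upwards [hgt, hL m] with n hmn hc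
        exact ⟨hmn, hc.trans (hs m hm)⟩
      exact (hd.and hsd).exists)
  exact ⟨g, d, fun m n h => (hg m n h).1, fun m n h => (hg m n h).2⟩

/-- The binary relation on a linear order that is `a` on the diagonal, `b` on increasing pairs and
`c` on decreasing pairs. -/
def orderPatternRel {X : Type*} [LT X] (a b c : Prop) (x y : X) : Prop :=
  (x = y ∧ a) ∨ (x < y ∧ b) ∨ (y < x ∧ c)

theorem binIso_orderPatternRel {X Y : Type*} [Preorder X] [Preorder Y] (e : X ≃o Y)
    (a b c : Prop) :
    BinIso (orderPatternRel a b c : X → X → Prop) (orderPatternRel a b c : Y → Y → Prop) :=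
  ⟨e.toEquiv, fun x y => by simp [orderPatternRel]⟩

theorem binIso_orderPatternRel_of_infinite {A : Set ℕ} (hA : A.Infinite) (a b c : Prop) :
    BinIso (orderPatternRel a b c : ℕ → ℕ → Prop)
      (fun x y : A => orderPatternRel a b c (x : ℕ) y) := by
  classical
  have := hA.to_subtype
  obtain ⟨e, he⟩ := binIso_orderPatternRel (Nat.Subtype.orderIsoOfNat A) a b c
  refine ⟨e, fun x y => (he x y).trans ?_⟩
  simp [orderPatternRel, ← Subtype.ext_iff]

theorem infinite_of_mem_binCopies {X : Type*} [Infinite X] {ρ : X → X → Prop} {A : Set X}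
    (hA : A ∈ BinCopies ρ) : A.Infinite := by
  obtain ⟨e, -⟩ := hA
  exact Set.infinite_coe_iff.mp (Infinite.of_injective e e.injective)

theorem binCopies_eq_infinite_of_binIso {ρ : ℕ → ℕ → Prop} {a b c : Prop}
    (h : BinIso ρ (orderPatternRel a b c : ℕ → ℕ → Prop)) :
    BinCopies ρ = {A : Set ℕ | A.Infinite} := by
  refine Set.Subset.antisymm (fun A => infinite_of_mem_binCopies) fun A hA => ?_
  obtain ⟨e, he⟩ := id h
  have restrict : BinIso (fun x y : A => ρ x y)
      (fun x y : e '' A => orderPatternRel a b c (x : ℕ) y) :=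
    ⟨e.image A, fun x y => he x y⟩
  have himage : (e '' A).Infinite := Set.Infinite.image e.injective.injOn hA
  exact (h.trans (binIso_orderPatternRel_of_infinite himage a b c)).trans restrict.symm

theorem exists_binIso_orderPatternRel {ρ : ℕ → ℕ → Prop}
    (h : BinCopies ρ = {A : Set ℕ | A.Infinite}) :
    ∃ a b c : Prop, BinIso ρ (orderPatternRel a b c : ℕ → ℕ → Prop) := by
  obtain ⟨g, ⟨a, b, c⟩, hg, hcol⟩ :=
    exists_strictMono_forall_lt_eq fun m n => (ρ m m, ρ m n, ρ n m)
  simp only [Prod.mk.injEq, eq_iff_iff] at hcol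
  have hrange : Set.range g ∈ BinCopies ρ := by
    rw [h]
    exact Set.infinite_range_of_injective hg.injective
  have hiso : BinIso ρ (fun x y : Set.range g => ρ x y) := hrange
  refine ⟨a, b, c, hiso.trans (BinIso.symm ⟨Equiv.ofInjective g hg.injective, ?_⟩)⟩
  intro m n
  simp only [Equiv.ofInjective_apply, orderPatternRel]
  rcases lt_trichotomy m n with hmn | rfl | hmn
  · simp [hmn, hmn.ne, hmn.not_gt, (hcol m n hmn).2.1]
  · simp [(hcol m (m + 1) m.lt_succ_self).1]
  · simp [hmn, hmn.ne', hmn.not_gt, (hcol n m hmn).2.2]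

/-- `P(X)` equals the family of all infinite subsets of `ℕ` iff `X = ⟨ℕ,ρ⟩` is isomorphic to
one of the eight structures: the empty relation, the complete graph, the natural strict order,
its inverse, the diagonal, the full relation, the natural order, or its inverse. -/
theorem binCopies_eq_infinite_iff (ρ : ℕ → ℕ → Prop) :
    BinCopies ρ = {A : Set ℕ | A.Infinite} ↔
      (BinIso ρ (fun (_ _ : ℕ) => False) ∨
       BinIso ρ (fun (m n : ℕ) => m ≠ n) ∨
       BinIso ρ (fun (m n : ℕ) => m < n) ∨
       BinIso ρ (fun (m n : ℕ) => n < m) ∨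
       BinIso ρ (fun (m n : ℕ) => m = n) ∨
       BinIso ρ (fun (_ _ : ℕ) => True) ∨
       BinIso ρ (fun (m n : ℕ) => m ≤ n) ∨
       BinIso ρ (fun (m n : ℕ) => n ≤ m)) := by
  have pattern_eq : ∀ {σ : ℕ → ℕ → Prop} (a b c : Prop),
      (∀ m n, orderPatternRel a b c m n ↔ σ m n) → (orderPatternRel a b c : ℕ → ℕ → Prop) = σ :=
    fun a b c hσ => funext₂ fun m n => propext (hσ m n)
  rw [← pattern_eq (σ := fun _ _ => False) False False False
      (by simp [orderPatternRel]),
    ← pattern_eq (σ := fun m n => m ≠ n) False True True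
      (by intros; grind [orderPatternRel]),
    ← pattern_eq (σ := fun m n => m < n) False True False
      (by simp [orderPatternRel]),
    ← pattern_eq (σ := fun m n => n < m) False False True
      (by simp [orderPatternRel]),
    ← pattern_eq (σ := fun m n => m = n) True False False
      (by simp [orderPatternRel]),
    ← pattern_eq (σ := fun _ _ => True) True True True
      (by intros; grind [orderPatternRel]),
    ← pattern_eq (σ := fun m n => m ≤ n) True True False
      (by intros; grind [orderPatternRel]),
    ← pattern_eq (σ := fun m n => n ≤ m) True False True
      (by intros; grind [orderPatternRel])]
  constructor
  · intro h
    obtain ⟨a, b, c, habc⟩ := exists_binIso_orderPatternRel h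
    by_cases ha : a <;> by_cases hb : b <;> by_cases hc : c <;>
      simp only [ha, hb, hc] at habc <;> tauto
  · rintro (h | h | h | h | h | h | h | h) <;> exact binCopies_eq_infinite_of_binIso h
end

section
/- Let X = ⟨ℕ,ρ⟩ be an indivisible binary structure. Then either I_X = Fin (the family of finite subsets of ℕ) or I_X is a tall ideal, i.e. every infinite S ⊆ ℕ has an infinite subset belonging to I_X. -/
/-- `I_X`: the family of subsets of the domain containing no copy of the structure. -/
def BinIdeal {X : Type*} (ρ : X → X → Prop) : Set (Set X) :=
  {S : Set X | ¬ ∃ A ∈ BinCopies ρ, A ⊆ S}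

/-- A binary structure is indivisible iff for every subset `S` of its domain it embeds into the
induced substructure on `S` or on its complement. -/
def BinIndivisible {X : Type*} (ρ : X → X → Prop) : Prop :=
  ∀ S : Set X, (∃ f : X → S, BinEmb ρ (fun a b : S => ρ a b) f) ∨
    (∃ f : X → ↥(Sᶜ), BinEmb ρ (fun a b : ↥(Sᶜ) => ρ a b) f)

/-- The relation on a linear order whose truth value at a pair depends only on the order type of
the pair. -/
def OrderPattern {α : Type*} [LT α] (l u d : Prop) (x y : α) : Prop :=
  (x = y ∧ l) ∨ (x < y ∧ u) ∨ (y < x ∧ d)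

theorem OrderPattern.orderIso_iff {α β : Type*} [Preorder α] [Preorder β] (e : α ≃o β)
    (l u d : Prop) (x y : α) : OrderPattern l u d (e x) (e y) ↔ OrderPattern l u d x y := by
  simp [OrderPattern]

theorem Ultrafilter.eventually_iff_eventually {α : Type*} (U : Ultrafilter α) (p : α → Prop) :
    ∀ᶠ x in U, (p x ↔ ∀ᶠ y in U, p y) := by
  by_cases hp : ∀ᶠ y in U, p y
  · simp [hp]
  · simpa [hp] using Ultrafilter.eventually_not.2 hp

/-- Ramsey's theorem for a binary relation: every infinite set of naturals contains an increasing
sequence along which the relation depends only on the order of the indices. -/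
theorem exists_strictMono_orderPattern (ρ : ℕ → ℕ → Prop) {S : Set ℕ} (hS : S.Infinite) :
    ∃ (f : ℕ → ℕ) (l u d : Prop), StrictMono f ∧ (∀ n, f n ∈ S) ∧
      ∀ m n, ρ (f m) (f n) ↔ OrderPattern l u d m n := by
  have : (Filter.cofinite ⊓ Filter.principal S).NeBot := hS.cofinite_inf_principal_neBot
  let U := Ultrafilter.of (Filter.cofinite ⊓ Filter.principal S)
  have hU : (U : Filter ℕ) ≤ Filter.cofinite ⊓ Filter.principal S := Ultrafilter.of_le _
  have hUS : ∀ᶠ x in U, x ∈ S := hU (Filter.mem_inf_of_right (Filter.mem_principal_self S))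
  have hgt (a : ℕ) : ∀ᶠ b in U, a < b := by
    refine hU (Filter.mem_inf_of_left ?_)
    rw [Nat.cofinite_eq_atTop]
    exact Filter.eventually_gt_atTop a
  let l : Prop := ∀ᶠ a in U, ρ a a
  let up (a : ℕ) : Prop := ∀ᶠ b in U, ρ a b
  let down (a : ℕ) : Prop := ∀ᶠ b in U, ρ b a
  let u : Prop := ∀ᶠ a in U, up a
  let d : Prop := ∀ᶠ a in U, down a
  obtain ⟨f, hf, hr⟩ := exists_seq_of_forall_finset_exists
    (fun a => a ∈ S ∧ (ρ a a ↔ l) ∧ (up a ↔ u) ∧ (down a ↔ d))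
    (fun a b => a < b ∧ (ρ a b ↔ u) ∧ (ρ b a ↔ d)) (by
      intro s hs
      have hall : ∀ᶠ b in U, ∀ a ∈ s, a < b ∧ (ρ a b ↔ u) ∧ (ρ b a ↔ d) := by
        rw [Filter.eventually_all_finset]
        intro a ha
        obtain ⟨-, -, hu, hd⟩ := hs a ha
        filter_upwards [hgt a, U.eventually_iff_eventually (fun b => ρ a b),
          U.eventually_iff_eventually (fun b => ρ b a)] with b h₁ h₂ h₃
        exact ⟨h₁, h₂.trans hu, h₃.trans hd⟩
      exact ((hUS.and ((U.eventually_iff_eventually fun a => ρ a a).and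
        ((U.eventually_iff_eventually up).and (U.eventually_iff_eventually down)))).and
          hall).exists)
  refine ⟨f, l, u, d, fun m n hmn => (hr m n hmn).1, fun n => (hf n).1, fun m n => ?_⟩
  rcases lt_trichotomy m n with h | rfl | h
  · simpa [OrderPattern, h, h.ne, h.not_gt] using (hr m n h).2.1
  · simpa [OrderPattern] using (hf m).2.1
  · simpa [OrderPattern, h, h.ne', h.not_gt] using (hr n m h).2.2

/-- If a structure on `ℕ` is pulled back from an order pattern along an injection, then every
infinite subset of `ℕ` is a copy of it. -/
theorem mem_binCopies_of_orderPattern {ρ : ℕ → ℕ → Prop} {k : ℕ → ℕ} (hk : Function.Injective k)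
    {l u d : Prop} (hρ : ∀ x y, ρ x y ↔ OrderPattern l u d (k x) (k y)) {B : Set ℕ}
    (hB : B.Infinite) : B ∈ BinCopies ρ := by
  classical
  have : Infinite (Set.range k) := (Set.infinite_range_of_injective hk).to_subtype
  have : Infinite (k '' B) := (hB.image hk.injOn).to_subtype
  let φ : Set.range k ≃o k '' B :=
    (Nat.Subtype.orderIsoOfNat (Set.range k)).symm.trans (Nat.Subtype.orderIsoOfNat (k '' B))
  let e : B ≃ k '' B := Equiv.Set.image k B hk
  have he (z : k '' B) : k (e.symm z) = z := congrArg Subtype.val (e.apply_symm_apply z)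
  refine ⟨((Equiv.ofInjective k hk).trans φ.toEquiv).trans e.symm, fun x y => ?_⟩
  have key := OrderPattern.orderIso_iff φ l u d (Equiv.ofInjective k hk x)
    (Equiv.ofInjective k hk y)
  simp only [hρ, Equiv.trans_apply, he]
  simp only [OrderPattern, Subtype.ext_iff] at key
  exact key.symm

theorem Set.Finite.mem_binIdeal {X : Type*} [Infinite X] {ρ : X → X → Prop} {S : Set X}
    (hS : S.Finite) : S ∈ BinIdeal ρ := by
  rintro ⟨A, ⟨e, -⟩, hAS⟩
  have := (hS.subset hAS).to_subtype
  exact not_finite_iff_infinite.2 ‹Infinite X› (Finite.of_equiv A e.symm)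

/-- For an indivisible binary structure `X = ⟨ℕ,ρ⟩`, either `I_X = Fin` or `I_X` is a tall
ideal: every infinite `S ⊆ ℕ` has an infinite subset belonging to `I_X`. -/
theorem binIdeal_fin_or_tall (ρ : ℕ → ℕ → Prop) (h : BinIndivisible ρ) :
    BinIdeal ρ = {S : Set ℕ | S.Finite} ∨
      ∀ S : Set ℕ, S.Infinite → ∃ T ⊆ S, T.Infinite ∧ T ∈ BinIdeal ρ := by
  rw [or_iff_not_imp_right]
  intro htall
  push Not at htall
  obtain ⟨S, hS, hcopy⟩ := htall
  obtain ⟨f, l, u, d, hf, hfS, hρ⟩ := exists_strictMono_orderPattern ρ hS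
  have hrange := hcopy (Set.range f) (Set.range_subset_iff.2 hfS)
    (Set.infinite_range_of_injective hf.injective)
  obtain ⟨A, ⟨e, he⟩, hAf⟩ := not_not.1 hrange
  choose k hk using fun n => hAf (e n).2
  have hkinj : Function.Injective k := fun x y hxy =>
    e.injective (Subtype.ext (by rw [← hk x, ← hk y, hxy]))
  have hpat (x y : ℕ) : ρ x y ↔ OrderPattern l u d (k x) (k y) := by
    simp only [he x y, ← hk, hρ]
  refine Set.Subset.antisymm (fun B hB => ?_) fun B hB => Set.Finite.mem_binIdeal hB
  by_contra hinf
  exact hB ⟨B, mem_binCopies_of_orderPattern hkinj hpat hinf, subset_rfl⟩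
end

section
/- Let ⟨X,ρ⟩ and ⟨Y,σ⟩ be binary structures, X = ⋃_{i∈I} X_i and Y = ⋃_{j∈J} Y_j partitions into pairwise disjoint nonempty sets such that ρ = ⋃_{i∈I} ρ_i and σ = ⋃_{j∈J} σ_j, where ρ_i = ρ ∩ (X_i×X_i), σ_j = σ ∩ (Y_j×Y_j), and each induced substructure ⟨X_i,ρ_i⟩ and ⟨Y_j,σ_j⟩ is connected. Then a map F : X → Y is an embedding of ⟨X,ρ⟩ into ⟨Y,σ⟩ if and only if there exist f : I → J and embeddings g_i : ⟨X_i,ρ_i⟩ → ⟨Y_{f(i)},σ_{f(i)}⟩ (i ∈ I) such that F(x) = g_i(x) for every i ∈ I and x ∈ X_i, and for all distinct i₁,i₂ ∈ I, all x₁ ∈ X_{i₁} and x₂ ∈ X_{i₂}, we have ¬(g_{i₁}(x₁) σ_rs g_{i₂}(x₂)), where σ_rs = Δ_Y ∪ σ ∪ σ⁻¹. -/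
/-- Embeddings of disjoint unions of connected binary structures: given partitions of `X` and
`Y` into pairwise disjoint nonempty pieces carrying all of `ρ` resp. `σ` and with connected
induced substructures, a map `F : X → Y` is an embedding of `⟨X,ρ⟩` into `⟨Y,σ⟩` iff there are
`f : I → J` and embeddings `gᵢ : ⟨Xᵢ,ρᵢ⟩ → ⟨Y_{f(i)},σ_{f(i)}⟩` with `F = ⋃ gᵢ` such that the
images of distinct pieces are not related by `σ_rs = Δ_Y ∪ σ ∪ σ⁻¹`. -/
theorem binEmb_of_disjoint_union_iff {X Y I J : Type*}
    (ρ : X → X → Prop) (σ : Y → Y → Prop) (Xp : I → Set X) (Yp : J → Set Y)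
    (hXdis : Pairwise fun i j => Disjoint (Xp i) (Xp j))
    (hXne : ∀ i, (Xp i).Nonempty)
    (hXcov : ⋃ i, Xp i = Set.univ)
    (hXρ : ∀ x y : X, ρ x y → ∃ i, x ∈ Xp i ∧ y ∈ Xp i)
    (hXconn : ∀ i, ∀ a b : Xp i, Relation.EqvGen (fun u v : Xp i => ρ u v) a b)
    (hYdis : Pairwise fun j k => Disjoint (Yp j) (Yp k))
    (hYne : ∀ j, (Yp j).Nonempty)
    (hYcov : ⋃ j, Yp j = Set.univ)
    (hYσ : ∀ y z : Y, σ y z → ∃ j, y ∈ Yp j ∧ z ∈ Yp j)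
    (hYconn : ∀ j, ∀ a b : Yp j, Relation.EqvGen (fun u v : Yp j => σ u v) a b)
    (F : X → Y) :
    BinEmb ρ σ F ↔
      ∃ f : I → J, ∃ g : ∀ i, Xp i → Yp (f i),
        (∀ i, BinEmb (fun a b : Xp i => ρ a b) (fun a b : Yp (f i) => σ a b) (g i)) ∧
        (∀ i, ∀ x : Xp i, F x = g i x) ∧
        (∀ i₁ i₂, i₁ ≠ i₂ → ∀ x₁ : Xp i₁, ∀ x₂ : Xp i₂,
          ¬ ((g i₁ x₁ : Y) = (g i₂ x₂ : Y) ∨ σ (g i₁ x₁) (g i₂ x₂) ∨ σ (g i₂ x₂) (g i₁ x₁))) := by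
  have hXuniq : ∀ {i j x}, x ∈ Xp i → x ∈ Xp j → i = j := fun {i j x} hi hj => by
    by_contra h
    exact Set.disjoint_left.1 (hXdis h) hi hj
  have hYuniq : ∀ {i j y}, y ∈ Yp i → y ∈ Yp j → i = j := fun {i j y} hi hj => by
    by_contra h
    exact Set.disjoint_left.1 (hYdis h) hi hj
  constructor
  · rintro ⟨hinj, hrel⟩
    have hpiece : ∀ i, ∃ j, ∀ x ∈ Xp i, F x ∈ Yp j := fun i => by
      obtain ⟨a, ha⟩ := hXne i
      obtain ⟨j, hj⟩ := Set.mem_iUnion.1 (hYcov.symm ▸ Set.mem_univ (F a))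
      refine ⟨j, fun x hx => ?_⟩
      have hiff : ∀ u v : Xp i, Relation.EqvGen (fun u v : Xp i => ρ u v) u v →
          (F u ∈ Yp j ↔ F v ∈ Yp j) := fun u v h => by
        induction h with
        | rel u v h =>
          obtain ⟨k, hu, hv⟩ := hYσ _ _ ((hrel _ _).1 h)
          exact ⟨fun h' => hYuniq hu h' ▸ hv, fun h' => hYuniq hv h' ▸ hu⟩
        | refl => exact Iff.rfl
        | symm _ _ _ ih => exact ih.symm
        | trans _ _ _ _ _ ih₁ ih₂ => exact ih₁.trans ih₂
      exact (hiff ⟨a, ha⟩ ⟨x, hx⟩ (hXconn i _ _)).1 hj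
    choose f hf using hpiece
    refine ⟨f, fun i x => ⟨F x, hf i x x.2⟩, fun i => ⟨fun a b h => ?_, fun a b => hrel a b⟩,
      fun _ _ => rfl, fun i₁ i₂ hne x₁ x₂ h => hne ?_⟩
    · exact Subtype.ext (hinj (congrArg Subtype.val h))
    · rcases h with h | h | h
      · exact hXuniq x₁.2 (hinj h ▸ x₂.2)
      · obtain ⟨k, h₁, h₂⟩ := hXρ _ _ ((hrel _ _).2 h)
        exact (hXuniq x₁.2 h₁).trans (hXuniq h₂ x₂.2)
      · obtain ⟨k, h₂, h₁⟩ := hXρ _ _ ((hrel _ _).2 h)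
        exact (hXuniq x₁.2 h₁).trans (hXuniq h₂ x₂.2)
  · rintro ⟨f, g, hg, hF, hsep⟩
    have hmem : ∀ x, ∃ i, x ∈ Xp i := fun x =>
      Set.mem_iUnion.1 (hXcov.symm ▸ Set.mem_univ x)
    refine ⟨fun x y h => ?_, fun x y => ⟨fun h => ?_, fun h => ?_⟩⟩
    · obtain ⟨i, hx⟩ := hmem x
      obtain ⟨j, hy⟩ := hmem y
      rw [hF i ⟨x, hx⟩, hF j ⟨y, hy⟩] at h
      obtain rfl : i = j := by
        by_contra hne
        exact hsep i j hne _ _ (Or.inl h)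
      exact congrArg Subtype.val ((hg i).1 (Subtype.ext h))
    · obtain ⟨i, hx, hy⟩ := hXρ x y h
      rw [hF i ⟨x, hx⟩, hF i ⟨y, hy⟩]
      exact ((hg i).2 ⟨x, hx⟩ ⟨y, hy⟩).1 h
    · obtain ⟨i, hx⟩ := hmem x
      obtain ⟨j, hy⟩ := hmem y
      rw [hF i ⟨x, hx⟩, hF j ⟨y, hy⟩] at h
      obtain rfl : i = j := by
        by_contra hne
        exact hsep i j hne _ _ (Or.inr (Or.inl h))
      exact ((hg i).2 ⟨x, hx⟩ ⟨y, hy⟩).2 h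
end

section
/- Let ⟨X,ρ⟩ be a binary structure whose components ⟨X_i, ρ∩(X_i×X_i)⟩, i ∈ I, are pairwise embedding-incomparable (for distinct i,j ∈ I, neither component embeds into the other). Then: (a) the map ⟨C_i : i∈I⟩ ↦ ⋃_{i∈I} C_i is an order isomorphism from the product poset ∏_{i∈I} ⟨P(X_i),⊆⟩ (ordered coordinatewise) onto ⟨P(X),⊆⟩; (b) if |I| ≥ 2, then ⟨X,ρ⟩ is divisible, i.e. not indivisible. -/
theorem mem_binCopies_iff {X : Type*} (ρ : X → X → Prop) (A : Set X) :
    A ∈ BinCopies ρ ↔ ∃ f : X → X, BinEmb ρ ρ f ∧ Set.range f = A := by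
  constructor
  · rintro ⟨e, he⟩
    refine ⟨fun x => e x, ⟨Subtype.val_injective.comp e.injective, he⟩, ?_⟩
    ext y
    constructor
    · rintro ⟨x, rfl⟩
      exact (e x).2
    · intro hy
      exact ⟨e.symm ⟨y, hy⟩, by simp⟩
  · rintro ⟨f, ⟨hinj, hf⟩, rfl⟩
    exact ⟨Equiv.ofInjective f hinj, hf⟩

/-- A relation-preserving map sends a connected piece into a single piece of a partition
carrying the relation. -/
theorem exists_piece_of_map {X I : Type*} (ρ : X → X → Prop) (Xp : I → Set X)
    (hdis : Pairwise fun i j => Disjoint (Xp i) (Xp j))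
    (hne : ∀ i, (Xp i).Nonempty)
    (hcov : ⋃ i, Xp i = Set.univ)
    (hρ : ∀ x y : X, ρ x y → ∃ i, x ∈ Xp i ∧ y ∈ Xp i)
    (hconn : ∀ i, ∀ a b : Xp i, Relation.EqvGen (fun u v : Xp i => ρ u v) a b)
    (f : X → X) (hf : ∀ x y, ρ x y → ρ (f x) (f y)) (i : I) :
    ∃ j, ∀ x ∈ Xp i, f x ∈ Xp j := by
  have huniq : ∀ {x j k}, x ∈ Xp j → x ∈ Xp k → j = k := fun {x j k} hj hk => by
    by_contra h
    exact Set.disjoint_left.1 (hdis h) hj hk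
  obtain ⟨a, ha⟩ := hne i
  obtain ⟨j, hj⟩ := Set.mem_iUnion.1 (hcov ▸ Set.mem_univ (f a))
  refine ⟨j, fun x hx => ?_⟩
  have key : ∀ u v : Xp i, Relation.EqvGen (fun u v : Xp i => ρ u v) u v →
      (f u ∈ Xp j ↔ f v ∈ Xp j) := by
    intro u v h
    induction h with
    | rel u v h =>
      obtain ⟨k, hu, hv⟩ := hρ _ _ (hf _ _ h)
      exact ⟨fun h => huniq hu h ▸ hv, fun h => huniq hv h ▸ hu⟩
    | refl u => exact Iff.rfl
    | symm u v _ ih => exact ih.symm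
    | trans u v w _ _ ih₁ ih₂ => exact ih₁.trans ih₂
  exact (key ⟨a, ha⟩ ⟨x, hx⟩ (hconn i _ _)).1 hj

/-- A self-embedding preserves every component when the components are pairwise
embedding-incomparable. -/
theorem BinEmb.mapsTo_component {X I : Type*} {ρ : X → X → Prop} {Xp : I → Set X}
    (hdis : Pairwise fun i j => Disjoint (Xp i) (Xp j))
    (hne : ∀ i, (Xp i).Nonempty)
    (hcov : ⋃ i, Xp i = Set.univ)
    (hρ : ∀ x y : X, ρ x y → ∃ i, x ∈ Xp i ∧ y ∈ Xp i)
    (hconn : ∀ i, ∀ a b : Xp i, Relation.EqvGen (fun u v : Xp i => ρ u v) a b)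
    (hinc : ∀ i j, i ≠ j →
      ¬ ∃ f : Xp i → Xp j, BinEmb (fun a b : Xp i => ρ a b) (fun a b : Xp j => ρ a b) f)
    {f : X → X} (hf : BinEmb ρ ρ f) (i : I) : Set.MapsTo f (Xp i) (Xp i) := by
  obtain ⟨j, hj⟩ := exists_piece_of_map ρ Xp hdis hne hcov hρ hconn f
    (fun x y => (hf.2 x y).1) i
  by_cases hij : i = j
  · subst hij
    exact hj
  · refine absurd ⟨fun a => ⟨f a, hj a a.2⟩, fun a b hab => ?_, fun a b => hf.2 a b⟩
      (hinc i j hij)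
    exact Subtype.ext (hf.1 (congrArg Subtype.val hab))

/-- Suppose the components `⟨Xᵢ,ρᵢ⟩` of the binary structure `⟨X,ρ⟩` (a partition of `X` into
pairwise disjoint nonempty connected pieces carrying all of `ρ`) are pairwise
embedding-incomparable.  Then: (a) `⟨C_i⟩ᵢ ↦ ⋃ᵢ Cᵢ` is an order isomorphism from the product
poset `∏ᵢ ⟨P(Xᵢ),⊆⟩` onto `⟨P(X),⊆⟩`; (b) if there are at least two components then `⟨X,ρ⟩` is
divisible. -/
theorem binCopies_of_incomparable_components {X I : Type*}
    (ρ : X → X → Prop) (Xp : I → Set X)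
    (hdis : Pairwise fun i j => Disjoint (Xp i) (Xp j))
    (hne : ∀ i, (Xp i).Nonempty)
    (hcov : ⋃ i, Xp i = Set.univ)
    (hρ : ∀ x y : X, ρ x y → ∃ i, x ∈ Xp i ∧ y ∈ Xp i)
    (hconn : ∀ i, ∀ a b : Xp i, Relation.EqvGen (fun u v : Xp i => ρ u v) a b)
    (hinc : ∀ i j, i ≠ j →
      ¬ ∃ f : Xp i → Xp j, BinEmb (fun a b : Xp i => ρ a b) (fun a b : Xp j => ρ a b) f) :
    ((∀ C : ∀ i, Set (Xp i), (∀ i, C i ∈ BinCopies (fun a b : Xp i => ρ a b)) →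
        (⋃ i, Subtype.val '' C i) ∈ BinCopies ρ) ∧
      (∀ B ∈ BinCopies ρ, ∃ C : ∀ i, Set (Xp i),
        (∀ i, C i ∈ BinCopies (fun a b : Xp i => ρ a b)) ∧ (⋃ i, Subtype.val '' C i) = B) ∧
      (∀ C D : ∀ i, Set (Xp i), (∀ i, C i ∈ BinCopies (fun a b : Xp i => ρ a b)) →
        (∀ i, D i ∈ BinCopies (fun a b : Xp i => ρ a b)) →
        ((⋃ i, Subtype.val '' C i) ⊆ (⋃ i, Subtype.val '' D i) ↔ ∀ i, C i ⊆ D i))) ∧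
    ((∃ i j : I, i ≠ j) → ¬ BinIndivisible ρ) := by
  have huniq : ∀ {x j k}, x ∈ Xp j → x ∈ Xp k → j = k := fun {x j k} hj hk => by
    by_contra h
    exact Set.disjoint_left.1 (hdis h) hj hk
  have hex : ∀ x, ∃ i, x ∈ Xp i := fun x => Set.mem_iUnion.1 (hcov ▸ Set.mem_univ x)
  have hmaps : ∀ {f : X → X}, BinEmb ρ ρ f → ∀ i, Set.MapsTo f (Xp i) (Xp i) :=
    fun hf => hf.mapsTo_component hdis hne hcov hρ hconn hinc
  refine ⟨⟨?_, ?_, ?_⟩, ?_⟩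
  · intro C hC
    simp only [mem_binCopies_iff] at hC ⊢
    choose f hf hfC using hC
    choose idx hidx using hex
    obtain ⟨F, hF⟩ : ∃ F : X → X, ∀ i (a : Xp i), F a = f i a := by
      refine ⟨fun x => f (idx x) ⟨x, hidx x⟩, fun i a => ?_⟩
      obtain ⟨a, ha⟩ := a
      obtain rfl := huniq ha (hidx a)
      rfl
    have hFm : ∀ {i x}, x ∈ Xp i → F x ∈ Xp i := fun {i x} hx => by
      rw [hF i ⟨x, hx⟩]
      exact (f i ⟨x, hx⟩).2
    have hFρ : ∀ {i x y} (hx : x ∈ Xp i) (hy : y ∈ Xp i), ρ x y ↔ ρ (F x) (F y) :=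
      fun {i x y} hx hy => by
        rw [hF i ⟨x, hx⟩, hF i ⟨y, hy⟩]
        exact (hf i).2 ⟨x, hx⟩ ⟨y, hy⟩
    refine ⟨F, ⟨fun x y hxy => ?_, fun x y => ⟨fun h => ?_, fun h => ?_⟩⟩, ?_⟩
    · have hx := hidx x
      have hy := hidx y
      have hxy' : idx x = idx y := huniq (hFm hx) (hxy ▸ hFm hy)
      rw [← hxy'] at hy
      rw [hF _ ⟨x, hx⟩, hF _ ⟨y, hy⟩] at hxy
      exact congrArg Subtype.val ((hf _).1 (Subtype.ext hxy))
    · obtain ⟨i, hx, hy⟩ := hρ x y h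
      exact (hFρ hx hy).1 h
    · obtain ⟨i, hx, hy⟩ := hρ _ _ h
      have hx' := huniq hx (hFm (hidx x))
      have hy' := huniq hy (hFm (hidx y))
      exact (hFρ (hx' ▸ hidx x) (hy' ▸ hidx y)).2 h
    · ext y
      simp only [Set.mem_range, Set.mem_iUnion, ← hfC, Set.mem_image]
      constructor
      · rintro ⟨x, rfl⟩
        exact ⟨idx x, _, ⟨⟨x, hidx x⟩, rfl⟩, (hF _ ⟨x, hidx x⟩).symm⟩
      · rintro ⟨i, _, ⟨a, rfl⟩, rfl⟩
        exact ⟨a, hF i a⟩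
  · intro B hB
    obtain ⟨f, hf, rfl⟩ := (mem_binCopies_iff ρ B).1 hB
    refine ⟨fun i => Subtype.val ⁻¹' Set.range f, fun i => ?_, ?_⟩
    · rw [mem_binCopies_iff]
      refine ⟨fun a => ⟨f a, hmaps hf i a.2⟩, ⟨fun a b hab => ?_, fun a b => hf.2 a b⟩, ?_⟩
      · exact Subtype.ext (hf.1 (congrArg Subtype.val hab))
      · ext ⟨y, hy⟩
        constructor
        · rintro ⟨a, ha⟩
          exact ⟨a, congrArg Subtype.val ha⟩
        · rintro ⟨x, rfl⟩
          obtain ⟨k, hk⟩ := hex x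
          obtain rfl := huniq hy (hmaps hf k hk)
          exact ⟨⟨x, hk⟩, rfl⟩
    · simp only [Subtype.image_preimage_coe, ← Set.iUnion_inter, hcov, Set.univ_inter]
  · intro C D _ _
    constructor
    · intro h i a ha
      obtain ⟨j, b, hb, hba⟩ := Set.mem_iUnion.1 (h (Set.mem_iUnion.2 ⟨i, a, ha, rfl⟩))
      obtain rfl := huniq (hba ▸ b.2) a.2
      exact Subtype.ext hba ▸ hb
    · exact fun h => Set.iUnion_mono fun i => Set.image_mono (h i)
  · rintro ⟨i, j, hij⟩ h
    rcases h (Xp i) with ⟨f, hf⟩ | ⟨f, hf⟩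
    · have hg : BinEmb ρ ρ fun x => f x := ⟨Subtype.val_injective.comp hf.1, hf.2⟩
      obtain ⟨y, hy⟩ := hne j
      exact hij (huniq (f y).2 (hmaps hg j hy))
    · have hg : BinEmb ρ ρ fun x => f x := ⟨Subtype.val_injective.comp hf.1, hf.2⟩
      obtain ⟨x, hx⟩ := hne i
      exact (f x).2 (hmaps hg i hx)
end
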